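/- For every t > 0 and every integer a, ∫_{B_a} ρ(t,x) dμ(x) = p^a · ∫_{B_{−a}} exp(−σ·t·|x|^b) dμ(x). -/

import Mathlib

open MeasureTheory

/-- The fundamental solution `ρ(t,x)` of the p-adic diffusion equation with diffusion
constant `σ` and Vladimirov exponent `b`:
`ρ(t,x) = Σ_{r∈ℤ} (exp(−σ t p^{rb}) − exp(−σ t p^{(r+1)b})) p^r 1_{B_{−r}}(x)`. -/
noncomputable def rho (p : ℕ) [Fact p.Prime] (σ b : ℝ) (t : ℝ) (x : ℚ_[p]) : ℝ :=
  ∑' r : ℤ,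
    (Real.exp (-(σ * t * (p : ℝ) ^ ((r : ℝ) * b))) -
      Real.exp (-(σ * t * (p : ℝ) ^ (((r : ℝ) + 1) * b)))) *
    (p : ℝ) ^ (r : ℤ) *
    Set.indicator {y : ℚ_[p] | ‖y‖ ≤ (p : ℝ) ^ (-r : ℤ)} (fun _ => 1) x

theorem hasSum_int_sub_succ_of_antitone {f : ℤ → ℝ} (hf : Antitone f) {l m : ℝ}
    (hbot : Filter.Tendsto f Filter.atBot (nhds l))
    (htop : Filter.Tendsto f Filter.atTop (nhds m)) :
    HasSum (fun r : ℤ => f r - f (r + 1)) (l - m) := by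
  have hpos : HasSum (fun n : ℕ => f n - f (n + 1)) (f 0 - m) := by
    rw [hasSum_iff_tendsto_nat_of_nonneg fun n => sub_nonneg.2 (hf (by lia))]
    have h : ∀ n : ℕ, ∑ i ∈ Finset.range n, (f i - f (i + 1)) = f 0 - f n := fun n => by
      simpa using Finset.sum_range_sub' (fun i : ℕ => f i) n
    simp only [h]
    exact tendsto_const_nhds.sub (htop.comp tendsto_natCast_atTop_atTop)
  have hneg : HasSum (fun n : ℕ => f (-(n + 1 : ℤ)) - f (-(n + 1 : ℤ) + 1)) (l - f 0) := by
    rw [hasSum_iff_tendsto_nat_of_nonneg fun n => sub_nonneg.2 (hf (by lia))]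
    have h : ∀ n : ℕ, ∑ i ∈ Finset.range n, (f (-(i + 1 : ℤ)) - f (-(i + 1 : ℤ) + 1)) =
        f (-n) - f 0 := fun n => by
      simpa using Finset.sum_range_sub (fun i : ℕ => f (-i)) n
    simp only [h]
    exact (hbot.comp (Filter.tendsto_neg_atTop_atBot.comp
      tendsto_natCast_atTop_atTop)).sub tendsto_const_nhds
  simpa using HasSum.of_nat_of_neg_add_one (f := fun r : ℤ => f r - f (r + 1)) hpos hneg

theorem hasSum_int_sub_succ_mul_indicator_Ici {f : ℤ → ℝ} (hf : Antitone f)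
    (htop : Filter.Tendsto f Filter.atTop (nhds 0)) (k : ℤ) :
    HasSum (fun r : ℤ => (f r - f (r + 1)) * (Set.Ici k).indicator (fun _ => 1) r) (f k) := by
  have hbot : Filter.Tendsto (fun r => f (max r k)) Filter.atBot (nhds (f k)) :=
    tendsto_const_nhds.congr' <| (Filter.eventually_le_atBot k).mono fun r hr => by
      simp only [max_eq_right hr]
  have h := hasSum_int_sub_succ_of_antitone (f := fun r => f (max r k))
    (fun r s hrs => hf (max_le_max_right k hrs)) hbot
    (htop.congr' <| (Filter.eventually_ge_atTop k).mono fun r hr => by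
      simp only [max_eq_left hr])
  rw [sub_zero] at h
  refine h.congr_fun fun r => ?_
  by_cases hr : k ≤ r
  · simp [hr, max_eq_left (hr.trans (Int.le_add_one le_rfl))]
  · simp [hr, max_eq_right (not_le.1 hr).le, max_eq_right (Int.add_one_le_of_lt (not_le.1 hr))]

theorem setIntegral_tsum_mul_indicator {α ι : Type*} [MeasurableSpace α] [Countable ι]
    {μ : Measure α} {s : Set α} (hs : μ s ≠ ⊤) {S : ι → Set α}
    (hS : ∀ i, MeasurableSet (S i)) {c : ι → ℝ} (hc : ∀ i, 0 ≤ c i)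
    (hsum : Summable fun i => c i * μ.real (S i ∩ s)) :
    ∫ x in s, ∑' i, c i * (S i).indicator (fun _ => 1) x ∂μ = ∑' i, c i * μ.real (S i ∩ s) := by
  have : Fact (μ s < ⊤) := ⟨hs.lt_top⟩
  have hint : ∀ i, ∫ x in s, c i * (S i).indicator (fun _ => 1) x ∂μ = c i * μ.real (S i ∩ s) := by
    intro i
    rw [integral_const_mul, integral_indicator_const _ (hS i), smul_eq_mul, mul_one,
      measureReal_restrict_apply (hS i)]
  rw [← integral_tsum_of_summable_integral_norm]
  · simp only [hint]
  · exact fun i => ((integrable_const (1 : ℝ)).indicator (hS i)).const_mul _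
  · convert hsum using 2 with i
    rw [← hint]
    refine integral_congr_ae (Filter.Eventually.of_forall fun x => ?_)
    exact Real.norm_of_nonneg (mul_nonneg (hc i) (Set.indicator_nonneg (by simp) x))

namespace Padic

variable {p : ℕ} [Fact p.Prime]

theorem existsUnique_norm_sub_natCast_lt_one {y : ℚ_[p]} (hy : ‖y‖ ≤ 1) :
    ∃! n : ℕ, n < p ∧ ‖y - n‖ < 1 := by
  have h := PadicInt.existsUnique_mem_range (⟨y, hy⟩ : ℤ_[p])
  simp only [IsLocalRing.mem_maximalIdeal, PadicInt.mem_nonunits] at h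
  exact h

theorem norm_mul_zpow_le_one_iff (x : ℚ_[p]) (k : ℤ) :
    ‖x * (p : ℚ_[p]) ^ k‖ ≤ 1 ↔ ‖x‖ ≤ (p : ℝ) ^ k := by
  have hp : (0 : ℝ) < p := mod_cast (Fact.out : p.Prime).pos
  rw [norm_mul, norm_p_zpow, zpow_neg, ← div_eq_mul_inv, div_le_one (zpow_pos hp k)]

theorem norm_neg_add_le_zpow_iff (x : ℚ_[p]) (n : ℕ) (k : ℤ) :
    ‖-((n : ℚ_[p]) * (p : ℚ_[p]) ^ (-(k + 1))) + x‖ ≤ (p : ℝ) ^ k ↔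
      ‖x * (p : ℚ_[p]) ^ (k + 1) - n‖ < 1 := by
  have hp : (0 : ℝ) < p := mod_cast (Fact.out : p.Prime).pos
  have hp' : (p : ℚ_[p]) ≠ 0 := mod_cast (Fact.out : p.Prime).ne_zero
  have h : x * (p : ℚ_[p]) ^ (k + 1) - n =
      (-((n : ℚ_[p]) * (p : ℚ_[p]) ^ (-(k + 1))) + x) * (p : ℚ_[p]) ^ (k + 1) := by
    rw [add_mul, neg_mul, mul_assoc, ← zpow_add₀ hp', neg_add_cancel, zpow_zero]
    ring
  rw [h, norm_mul, norm_p_zpow, zpow_neg (p : ℝ), ← div_eq_mul_inv, div_lt_one (zpow_pos hp _),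
    norm_le_pow_iff_norm_lt_pow_add_one]

theorem setOf_norm_le_zpow_add_one (k : ℤ) :
    {x : ℚ_[p] | ‖x‖ ≤ (p : ℝ) ^ (k + 1)} =
      ⋃ n ∈ Finset.range p,
        (fun x => -((n : ℚ_[p]) * (p : ℚ_[p]) ^ (-(k + 1))) + x) ⁻¹'
          {x : ℚ_[p] | ‖x‖ ≤ (p : ℝ) ^ k} := by
  ext x
  simp only [Set.mem_iUnion, Set.mem_preimage, Set.mem_ofPred_eq, Finset.mem_range, exists_prop,
    norm_neg_add_le_zpow_iff, ← norm_mul_zpow_le_one_iff x (k + 1)]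
  refine ⟨fun h => (existsUnique_norm_sub_natCast_lt_one h).exists, fun ⟨n, _, h⟩ => ?_⟩
  rw [← sub_add_cancel (x * (p : ℚ_[p]) ^ (k + 1)) (n : ℚ_[p])]
  exact (nonarchimedean _ _).trans (max_le h.le (by simpa using norm_int_le_one (p := p) n))

theorem measurableSet_norm_le [MeasurableSpace ℚ_[p]] [BorelSpace ℚ_[p]] (r : ℝ) :
    MeasurableSet {x : ℚ_[p] | ‖x‖ ≤ r} :=
  (isClosed_le continuous_norm continuous_const).measurableSet

theorem addHaar_norm_le_ne_top [MeasurableSpace ℚ_[p]] {μ : Measure ℚ_[p]} [μ.IsAddHaarMeasure]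
    (r : ℝ) : μ {x : ℚ_[p] | ‖x‖ ≤ r} ≠ ⊤ := by
  have h : {x : ℚ_[p] | ‖x‖ ≤ r} = Metric.closedBall 0 r := by ext; simp
  rw [h]
  exact (isCompact_closedBall 0 r).measure_ne_top

section Haar

variable [MeasurableSpace ℚ_[p]] [BorelSpace ℚ_[p]] {μ : Measure ℚ_[p]} [μ.IsAddHaarMeasure]

theorem addHaar_norm_le_zpow_add_one (k : ℤ) :
    μ {x : ℚ_[p] | ‖x‖ ≤ (p : ℝ) ^ (k + 1)} = p * μ {x : ℚ_[p] | ‖x‖ ≤ (p : ℝ) ^ k} := by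
  rw [setOf_norm_le_zpow_add_one, measure_biUnion_finset]
  · simp only [measure_preimage_add, Finset.sum_const, Finset.card_range, nsmul_eq_mul]
  · intro m hm n hn hmn
    refine Set.disjoint_left.2 fun x hx hx' => hmn ?_
    have hx1 : ‖x‖ ≤ (p : ℝ) ^ (k + 1) := by
      change x ∈ {x : ℚ_[p] | ‖x‖ ≤ (p : ℝ) ^ (k + 1)}
      rw [setOf_norm_le_zpow_add_one]
      exact Set.mem_biUnion hm hx
    refine (existsUnique_norm_sub_natCast_lt_one ((norm_mul_zpow_le_one_iff x (k + 1)).2 hx1)).unique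
      ⟨Finset.mem_range.1 hm, (norm_neg_add_le_zpow_iff x m k).1 hx⟩
      ⟨Finset.mem_range.1 hn, (norm_neg_add_le_zpow_iff x n k).1 hx'⟩
  · exact fun n _ => measurable_const_add _ (measurableSet_norm_le _)

theorem addHaar_real_norm_le_zpow (hμ : μ {x : ℚ_[p] | ‖x‖ ≤ 1} = 1) (k : ℤ) :
    μ.real {x : ℚ_[p] | ‖x‖ ≤ (p : ℝ) ^ k} = (p : ℝ) ^ k := by
  have hp : (p : ℝ) ≠ 0 := mod_cast (Fact.out : p.Prime).ne_zero
  have hstep : ∀ k : ℤ, μ.real {x : ℚ_[p] | ‖x‖ ≤ (p : ℝ) ^ (k + 1)} =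
      p * μ.real {x : ℚ_[p] | ‖x‖ ≤ (p : ℝ) ^ k} := fun k => by
    simp [measureReal_def, addHaar_norm_le_zpow_add_one]
  induction k using Int.induction_on with
  | zero => simp [measureReal_def, hμ]
  | succ k ih => rw [hstep, ih, zpow_add_one₀ hp, mul_comm]
  | pred k ih =>
    have h := hstep (-k - 1)
    rw [sub_add_cancel, ih] at h
    refine mul_left_cancel₀ hp ?_
    rw [← h, ← zpow_one_add₀ hp, add_sub_cancel]

theorem addHaar_real_norm_le_zpow_inter (hμ : μ {x : ℚ_[p] | ‖x‖ ≤ 1} = 1) (k m : ℤ) :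
    μ.real ({x : ℚ_[p] | ‖x‖ ≤ (p : ℝ) ^ k} ∩ {x : ℚ_[p] | ‖x‖ ≤ (p : ℝ) ^ m}) =
      (p : ℝ) ^ min k m := by
  have hp : (1 : ℝ) < p := mod_cast (Fact.out : p.Prime).one_lt
  rw [← addHaar_real_norm_le_zpow hμ (min k m), (zpow_right_strictMono₀ hp).monotone.map_min]
  simp only [le_min_iff, Set.ofPred_and]

end Haar

end Padic

section ExpProfile

variable {q c b : ℝ}

theorem antitone_exp_neg_mul_rpow (hq : 1 < q) (hc : 0 < c) (hb : 0 < b) :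
    Antitone fun r : ℤ => Real.exp (-(c * q ^ ((r : ℝ) * b))) := by
  intro r s hrs
  have : (r : ℝ) ≤ s := mod_cast hrs
  dsimp only
  gcongr
  exact hq.le

theorem tendsto_exp_neg_mul_rpow_atTop (hq : 1 < q) (hc : 0 < c) (hb : 0 < b) :
    Filter.Tendsto (fun r : ℤ => Real.exp (-(c * q ^ ((r : ℝ) * b)))) Filter.atTop (nhds 0) := by
  refine Real.tendsto_exp_neg_atTop_nhds_zero.comp (Filter.Tendsto.const_mul_atTop hc ?_)
  exact (tendsto_rpow_atTop_of_base_gt_one q hq).comp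
    (tendsto_intCast_atTop_atTop.atTop_mul_const hb)

theorem tendsto_exp_neg_mul_rpow_atBot (hq : 1 < q) (hb : 0 < b) :
    Filter.Tendsto (fun r : ℤ => Real.exp (-(c * q ^ ((r : ℝ) * b)))) Filter.atBot (nhds 1) := by
  have h : Filter.Tendsto (fun r : ℤ => q ^ ((r : ℝ) * b)) Filter.atBot (nhds 0) :=
    (tendsto_rpow_atBot_of_base_gt_one q hq).comp
      ((tendsto_intCast_atBot_iff.2 Filter.tendsto_id).atBot_mul_const hb)
  simpa [Function.comp_def] using (Real.continuous_exp.tendsto _).comp (h.const_mul c).neg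

theorem hasSum_exp_neg_mul_norm_rpow {p : ℕ} [Fact p.Prime] (hc : 0 < c) (hb : 0 < b)
    (x : ℚ_[p]) :
    HasSum (fun r : ℤ =>
      (Real.exp (-(c * (p : ℝ) ^ ((r : ℝ) * b))) -
        Real.exp (-(c * (p : ℝ) ^ (((r : ℝ) + 1) * b)))) *
      {y : ℚ_[p] | ‖y‖ ≤ (p : ℝ) ^ r}.indicator (fun _ => 1) x)
      (Real.exp (-(c * ‖x‖ ^ b))) := by
  have hp : (1 : ℝ) < p := mod_cast (Fact.out : p.Prime).one_lt
  have hanti := antitone_exp_neg_mul_rpow hp hc hb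
  have htop := tendsto_exp_neg_mul_rpow_atTop hp hc hb
  rcases eq_or_ne x 0 with rfl | hx
  · have h := hasSum_int_sub_succ_of_antitone hanti (tendsto_exp_neg_mul_rpow_atBot hp hb) htop
    have hr (r : ℤ) : (0 : ℝ) ≤ (p : ℝ) ^ r := by positivity
    simpa [hr, Real.zero_rpow hb.ne'] using h
  · have h := hasSum_int_sub_succ_mul_indicator_Ici hanti htop (-x.valuation)
    rw [Real.rpow_mul (by positivity), Real.rpow_intCast, ← Padic.norm_eq_zpow_neg_valuation hx] at h
    refine h.congr_fun fun r => ?_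
    have hmem : x ∈ {y : ℚ_[p] | ‖y‖ ≤ (p : ℝ) ^ r} ↔ r ∈ Set.Ici (-x.valuation) := by
      rw [Set.mem_ofPred_eq, Padic.norm_eq_zpow_neg_valuation hx, zpow_le_zpow_iff_right₀ hp,
        Set.mem_Ici]
    simp only [Set.indicator_apply, hmem, Int.cast_add, Int.cast_one]

end ExpProfile

/-- For every `t > 0` and every integer `a`,
`∫_{B_a} ρ(t,x) dμ(x) = p^a · ∫_{B_{−a}} exp(−σ·t·|x|^b) dμ(x)`. -/
theorem exit_prob_statement_6 (p : ℕ) [Fact p.Prime]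
    [MeasurableSpace ℚ_[p]] [BorelSpace ℚ_[p]]
    (μ : Measure ℚ_[p]) [μ.IsAddHaarMeasure]
    (hμ : μ {x : ℚ_[p] | ‖x‖ ≤ 1} = 1)
    (σ b : ℝ) (hσ : 0 < σ) (hb : 0 < b)
    (t : ℝ) (ht : 0 < t) (a : ℤ) :
    ∫ x in {x : ℚ_[p] | ‖x‖ ≤ (p : ℝ) ^ a}, rho p σ b t x ∂μ =
      (p : ℝ) ^ a *
        ∫ x in {x : ℚ_[p] | ‖x‖ ≤ (p : ℝ) ^ (-a)}, Real.exp (-(σ * t * ‖x‖ ^ b)) ∂μ := by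
  have hp : (1 : ℝ) < p := mod_cast (Fact.out : p.Prime).one_lt
  have hp0 : (p : ℝ) ≠ 0 := by positivity
  have hc : 0 < σ * t := mul_pos hσ ht
  have hanti := antitone_exp_neg_mul_rpow hp hc hb
  set D : ℤ → ℝ := fun r => Real.exp (-(σ * t * (p : ℝ) ^ ((r : ℝ) * b))) -
    Real.exp (-(σ * t * (p : ℝ) ^ (((r : ℝ) + 1) * b))) with hD
  have hD0 : ∀ r, 0 ≤ D r := fun r => by
    simpa [hD] using hanti (Int.le_add_one (le_refl r))
  have hDsum : Summable D := by
    simpa [hD] using (hasSum_int_sub_succ_of_antitone hanti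
      (tendsto_exp_neg_mul_rpow_atBot hp hb) (tendsto_exp_neg_mul_rpow_atTop hp hc hb)).summable
  have hsum (m : ℤ) : Summable fun r => D r * (p : ℝ) ^ min r m :=
    (hDsum.mul_right ((p : ℝ) ^ m)).of_nonneg_of_le
      (fun r => mul_nonneg (hD0 r) (by positivity)) fun r =>
        mul_le_mul_of_nonneg_left (zpow_le_zpow_right₀ hp.le (min_le_right r m)) (hD0 r)
  have hexp (r : ℤ) : D r * (p : ℝ) ^ r * (p : ℝ) ^ min (-r) a =
      (p : ℝ) ^ a * (D r * (p : ℝ) ^ min r (-a)) := by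
    rw [mul_assoc, ← zpow_add₀ hp0, mul_left_comm, ← zpow_add₀ hp0]
    congr 2
    lia
  have hL := setIntegral_tsum_mul_indicator (μ := μ)
    (Padic.addHaar_norm_le_ne_top ((p : ℝ) ^ a))
    (S := fun r : ℤ => {y : ℚ_[p] | ‖y‖ ≤ (p : ℝ) ^ (-r)})
    (fun r => Padic.measurableSet_norm_le _) (c := fun r => D r * (p : ℝ) ^ r)
    (fun r => mul_nonneg (hD0 r) (by positivity))
    (by simpa only [Padic.addHaar_real_norm_le_zpow_inter hμ, hexp] using (hsum (-a)).mul_left _)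
  have hR := setIntegral_tsum_mul_indicator (μ := μ)
    (Padic.addHaar_norm_le_ne_top ((p : ℝ) ^ (-a)))
    (S := fun r : ℤ => {y : ℚ_[p] | ‖y‖ ≤ (p : ℝ) ^ r})
    (fun r => Padic.measurableSet_norm_le _) hD0
    (by simpa only [Padic.addHaar_real_norm_le_zpow_inter hμ] using hsum (-a))
  simp only [Padic.addHaar_real_norm_le_zpow_inter hμ, hexp, tsum_mul_left] at hL hR
  simp only [hD, (hasSum_exp_neg_mul_norm_rpow hc hb _).tsum_eq] at hR
  rw [hR]
  exact hL
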